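/- Assume V is real-valued, θ₀, θ_R, θ₀', θ_R' ∈ (0,π), and let z ∈ ℝ with z < e₀ be sufficiently negative. Write H' = H_{θ₀',θ_R'} and define B(z) := (H' − zI)^{1/2}[γ_{θ₀,θ_R}(H' − zI)^{-1}]*, a bounded operator from ℂ² to L²((0,R);dx). Then the 2×2 matrices satisfy Λ_{θ₀',θ_R'}^{θ₀,θ_R}(z) S_{θ₀−θ₀',θ_R−θ_R'} = B(z)*B(z) + diag( sin(θ₀−θ₀')sin(θ₀)/sin(θ₀') , sin(θ_R−θ_R')sin(θ_R)/sin(θ_R') ). -/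

import Mathlib

open MeasureTheory Filter
open scoped InnerProductSpace

noncomputable section
open scoped Classical


variable {H : Type*} [NormedAddCommGroup H] [InnerProductSpace ℂ H] [CompleteSpace H]

/-- `T` is the (bounded, everywhere defined) inverse of `A - z·I`. -/
def IsResolvent (A : H →ₗ.[ℂ] H) (z : ℂ) (T : H →L[ℂ] H) : Prop :=
  (∀ x : H, ∃ hx : T x ∈ A.domain, A ⟨T x, hx⟩ - z • T x = x) ∧
  ∀ u : A.domain, T (A u - z • (u : H)) = (u : H)

/-- The resolvent set of an unbounded operator. -/
def resolventSetP (A : H →ₗ.[ℂ] H) : Set ℂ := {z | ∃ T, IsResolvent A z T}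

/-- The spectrum of an unbounded operator. -/
def specP (A : H →ₗ.[ℂ] H) : Set ℂ := (resolventSetP A)ᶜ

/-- The resolvent `(A - z·I)⁻¹` (junk value `0` off the resolvent set). -/
def res (A : H →ₗ.[ℂ] H) (z : ℂ) : H →L[ℂ] H :=
  if h : ∃ T, IsResolvent A z T then h.choose else 0

/-- The operator `A + t·I` (same domain). -/
def shiftP (A : H →ₗ.[ℂ] H) (t : ℂ) : H →ₗ.[ℂ] H :=
  ⟨A.domain, A.toFun + t • A.domain.subtype⟩

/-- `A` is of positive type: `(-∞,0] ⊆ ρ(A)` and `sup_{t ≥ 0} ‖(1+t)(A+t)⁻¹‖ < ∞`. -/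
def IsPositiveTypeP (A : H →ₗ.[ℂ] H) : Prop :=
  (∀ x : ℝ, x ≤ 0 → (x : ℂ) ∈ resolventSetP A) ∧
  ∃ M : ℝ, ∀ t : ℝ, 0 ≤ t → (1 + t) * ‖res A (-(t : ℂ))‖ ≤ M

/-- The open sector of half-opening angle `ω` about the positive reals
(`(0,∞)` for `ω = 0`). -/
def sectorS (ω : ℝ) : Set ℂ :=
  if ω = 0 then (fun x : ℝ => (x : ℂ)) '' Set.Ioi 0
  else {z : ℂ | z ≠ 0 ∧ |Complex.arg z| < ω}

/-- `A` is sectorial of angle `ω`. -/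
def IsSectorialP (A : H →ₗ.[ℂ] H) (ω : ℝ) : Prop :=
  specP A ⊆ closure (sectorS ω) ∧
  ∀ ω' : ℝ, ω < ω' → ω' < Real.pi →
    ∃ M : ℝ, ∀ z ∈ (closure (sectorS ω'))ᶜ, ‖z‖ * ‖res A z‖ ≤ M

/-- The shifted sector `-t₀ + S_ω`. -/
def shiftedSector (t0 ω : ℝ) : Set ℂ := (fun w => -(t0 : ℂ) + w) '' sectorS ω

/-- The region `ℂ \ closure (-t₀ + S_ω)`. -/
def offSector (t0 ω : ℝ) : Set ℂ := (closure (shiftedSector t0 ω))ᶜ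

/-- The bounded operator `(A - z·I)^{-1/2}`, defined by the Balakrishnan-type formula
`(1/π) ∫₀^∞ t^{-1/2} (A + (t - z)·I)⁻¹ dt`. -/
def negSqrt (A : H →ₗ.[ℂ] H) (z : ℂ) : H →L[ℂ] H :=
  ((Real.pi : ℂ))⁻¹ • ∫ t in Set.Ioi (0 : ℝ), ((Real.sqrt t : ℂ))⁻¹ • res A (z - t)

/-- Trace-class (nuclear) bounded operators, characterized by
`sup { ∑ |⟨eᵢ, T fᵢ⟩| : (eᵢ), (fᵢ) finite orthonormal families } < ∞`. -/
def IsTraceClass (T : H →L[ℂ] H) : Prop :=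
  ∃ C : ℝ, ∀ (n : ℕ) (e f : Fin n → H), Orthonormal ℂ e → Orthonormal ℂ f →
    ∑ i, ‖⟪e i, T (f i)⟫_ℂ‖ ≤ C

/-- The trace norm `‖T‖₁`. -/
def traceNorm (T : H →L[ℂ] H) : ℝ :=
  sSup {s : ℝ | ∃ (n : ℕ) (e f : Fin n → H), Orthonormal ℂ e ∧ Orthonormal ℂ f ∧
    s = ∑ i, ‖⟪e i, T (f i)⟫_ℂ‖}

/-- The trace of a (trace-class) operator, computed in the Hilbert basis `b`. -/
def traceH (b : HilbertBasis ℕ ℂ H) (T : H →L[ℂ] H) : ℂ :=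
  ∑' n, ⟪(b n : H), T (b n)⟫_ℂ

/-- The Fredholm determinant `det (I + T)` (for `T` trace class), computed as the limit of
finite-section determinants along the Hilbert basis `b`. -/
def detI (b : HilbertBasis ℕ ℂ H) (T : H →L[ℂ] H) : ℂ :=
  limUnder atTop fun F : Finset ℕ =>
    Matrix.det (Matrix.of fun i j : F =>
      (if (i : ℕ) = (j : ℕ) then (1 : ℂ) else 0) + ⟪(b (i : ℕ) : H), T (b (j : ℕ))⟫_ℂ)


/-! ### One-dimensional Schrödinger operators on `[0,R]` -/

/-- The underlying Hilbert space `L²((0,R); dx)`. -/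
abbrev SchSp (Rr : ℝ) :=
  MeasureTheory.Lp ℂ 2 (MeasureTheory.volume.restrict (Set.Ioo (0 : ℝ) Rr))

/-- `u` (with derivative `du`) solves `-u'' + V u = z u` on `[0,R]`, with
`u, u' ∈ AC([0,R])` (the second derivative being encoded in integrated form). -/
def SolODE (Rr : ℝ) (V : ℝ → ℂ) (z : ℂ) (u du : ℝ → ℂ) : Prop :=
  (∀ x ∈ Set.Icc (0 : ℝ) Rr, HasDerivWithinAt u (du x) (Set.Icc (0 : ℝ) Rr) x) ∧
  ∀ x ∈ Set.Icc (0 : ℝ) Rr, du x = du 0 + ∫ t in (0 : ℝ)..x, (V t - z) * u t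

/-- The boundary trace `γ_{θ₀,θ_R}(u) = (cos θ₀ u(0) + sin θ₀ u'(0),
cos θ_R u(R) - sin θ_R u'(R))`. -/
def bdryC (Rr : ℝ) (t0 tR : ℂ) (u du : ℝ → ℂ) : Fin 2 → ℂ :=
  ![Complex.cos t0 * u 0 + Complex.sin t0 * du 0,
    Complex.cos tR * u Rr - Complex.sin tR * du Rr]

/-- `g` (with derivative `dg`) is an absolutely continuous representative of `f ∈ L²`
satisfying `-g'' + V g - z g = h` (in integrated form, with `h₀` a representative of
`h ∈ L²`); i.e. `f` represents `(H - z)⁻¹ h`. -/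
def SolvesAt (Rr : ℝ) (V : ℝ → ℂ) (z : ℂ) (f h : SchSp Rr) (g dg : ℝ → ℂ) : Prop :=
  (∀ᵐ x ∂(MeasureTheory.volume.restrict (Set.Ioo (0 : ℝ) Rr)), f x = g x) ∧
  (∀ x ∈ Set.Icc (0 : ℝ) Rr, HasDerivWithinAt g (dg x) (Set.Icc (0 : ℝ) Rr) x) ∧
  ∃ h0 : ℝ → ℂ,
    (∀ᵐ x ∂(MeasureTheory.volume.restrict (Set.Ioo (0 : ℝ) Rr)), h x = h0 x) ∧
    ∀ x ∈ Set.Icc (0 : ℝ) Rr,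
      dg x = dg 0 + ∫ t in (0 : ℝ)..x, (V t * g t - z * g t - h0 t)

/-- `Hop` is the Schrödinger operator `H_{θ₀,θ_R} = -d²/dx² + V` in `L²((0,R); dx)` with
separated boundary conditions `γ_{θ₀,θ_R}(g) = 0`, characterized through its graph. -/
def IsSchrodingerOp (Rr : ℝ) (V : ℝ → ℂ) (t0 tR : ℂ)
    (Hop : SchSp Rr →ₗ.[ℂ] SchSp Rr) : Prop :=
  ∀ f h : SchSp Rr, (f, h) ∈ Hop.graph ↔
    ∃ g dg : ℝ → ℂ, SolvesAt Rr V 0 f h g dg ∧ bdryC Rr t0 tR g dg = 0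

/-- `Λ` is the boundary data map `Λ_{θ₀,θ_R}^{θ₀',θ_R'}(z)`: for every solution `u` of
`-u'' + Vu = zu`, `Λ` maps `γ_{θ₀,θ_R}(u)` to `γ_{θ₀',θ_R'}(u)`. -/
def IsBoundaryDataMap (Rr : ℝ) (V : ℝ → ℂ) (t0 tR t0' tR' : ℂ) (z : ℂ)
    (Λ : Matrix (Fin 2) (Fin 2) ℂ) : Prop :=
  ∀ u du : ℝ → ℂ, SolODE Rr V z u du →
    Λ.mulVec (bdryC Rr t0 tR u du) = bdryC Rr t0' tR' u du

/-- `G` is the map `γ_{θ₀',θ_R'} ∘ (Hop - z)⁻¹ : L²((0,R)) → ℂ²`. -/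
def IsBdryResolventMap (Rr : ℝ) (V : ℝ → ℂ) (t0' tR' : ℂ) (z : ℂ)
    (Hop : SchSp Rr →ₗ.[ℂ] SchSp Rr)
    (G : SchSp Rr →L[ℂ] EuclideanSpace ℂ (Fin 2)) : Prop :=
  ∀ (h : SchSp Rr) (g dg : ℝ → ℂ), SolvesAt Rr V z (res Hop z h) h g dg →
    ∀ i : Fin 2, G h i = bdryC Rr t0' tR' g dg i

/-- The region `ℂ \ [c, ∞)`. -/
def offCut (c : ℝ) : Set ℂ := {z : ℂ | z.im ≠ 0 ∨ z.re < c}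

/-- `N` is the family `z ↦ (Hop - z)^{-1/2}`, defined via the spectral theorem with branch
cut along `[c, ∞)` (`c = inf σ(Hop)`): analytic on `ℂ \ [c,∞)`, squaring to the resolvent,
and positive (self-adjoint) for real `z < c`. -/
def IsSqrtResFam (Rr : ℝ) (Hop : SchSp Rr →ₗ.[ℂ] SchSp Rr) (c : ℝ)
    (N : ℂ → (SchSp Rr →L[ℂ] SchSp Rr)) : Prop :=
  (∀ z ∈ offCut c, (N z).comp (N z) = res Hop z) ∧
  (∀ x : ℝ, x < c →
    (∀ v w : SchSp Rr, ⟪N (x : ℂ) v, w⟫_ℂ = ⟪v, N (x : ℂ) w⟫_ℂ) ∧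
    ∀ v : SchSp Rr, 0 ≤ (⟪v, N (x : ℂ) v⟫_ℂ).re) ∧
  DifferentiableOn ℂ N (offCut c)

/-- The infimum `e₀ = inf(σ(Hop) ∪ σ(Hop'))`. -/
def einf (Rr : ℝ) (Hop Hop' : SchSp Rr →ₗ.[ℂ] SchSp Rr) : ℝ :=
  sInf {x : ℝ | (x : ℂ) ∈ specP Hop ∪ specP Hop'}

/-- The infimum of the spectrum of a single operator. -/
def einf1 (Rr : ℝ) (Hop : SchSp Rr →ₗ.[ℂ] SchSp Rr) : ℝ :=
  sInf {x : ℝ | (x : ℂ) ∈ specP Hop}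


/-- `g` is `C¹` on `[0,R]` with derivative `dg`, which is a primitive of `p ∈ L¹(0,R)`. -/
structure IsPrimitiveTwice (Rr : ℝ) (g dg p : ℝ → ℂ) : Prop where
  hasDeriv : ∀ x ∈ Set.Icc (0 : ℝ) Rr, HasDerivWithinAt g (dg x) (Set.Icc (0 : ℝ) Rr) x
  integrable : IntervalIntegrable p volume 0 Rr
  eq_add_integral : ∀ x ∈ Set.Icc (0 : ℝ) Rr, dg x = dg 0 + ∫ t in (0 : ℝ)..x, p t

namespace IsPrimitiveTwice

variable {Rr : ℝ} {g dg p : ℝ → ℂ}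

lemma continuousOn (h : IsPrimitiveTwice Rr g dg p) : ContinuousOn g (Set.Icc 0 Rr) :=
  fun x hx => (h.hasDeriv x hx).continuousWithinAt

lemma continuousOn_deriv (h : IsPrimitiveTwice Rr g dg p) (hR : 0 < Rr) :
    ContinuousOn dg (Set.Icc 0 Rr) := by
  have h1 := intervalIntegral.continuousOn_primitive_interval' h.integrable
    (Set.left_mem_uIcc (a := (0 : ℝ)) (b := Rr))
  rw [Set.uIcc_of_le hR.le] at h1
  exact (continuousOn_const.add h1).congr h.eq_add_integral

end IsPrimitiveTwice

lemma integral_sub_of_hasDerivWithinAt {a b : ℝ} (hab : a ≤ b) {w dw : ℝ → ℂ} {S : Set ℝ}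
    (hS : Set.Icc a b ⊆ S)
    (hw : ∀ x ∈ S, HasDerivWithinAt w (dw x) S x)
    (hdw : ContinuousOn dw S) : ∫ t in a..b, dw t = w b - w a := by
  refine intervalIntegral.integral_eq_sub_of_hasDerivAt_of_le hab ?_ ?_ ?_
  · exact fun x hx => ((hw x (hS hx)).mono hS).continuousWithinAt
  · intro x hx
    exact ((hw x (hS (Set.Ioo_subset_Icc_self hx))).mono hS).hasDerivAt (Icc_mem_nhds hx.1 hx.2)
  · exact ContinuousOn.intervalIntegrable_of_Icc hab (hdw.mono hS)

/-- Integration by parts on a triangle. -/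
lemma integral_mul_primitive {Rr : ℝ} (hR : 0 < Rr) {w dw p : ℝ → ℂ}
    (hw : ∀ x ∈ Set.Icc (0 : ℝ) Rr, HasDerivWithinAt w (dw x) (Set.Icc (0 : ℝ) Rr) x)
    (hdw : ContinuousOn dw (Set.Icc 0 Rr)) (hp : IntervalIntegrable p volume 0 Rr) :
    ∫ t in (0 : ℝ)..Rr, dw t * ∫ s in (0 : ℝ)..t, p s =
      ∫ s in (0 : ℝ)..Rr, (w Rr - w s) * p s := by
  set μ := volume.restrict (Set.Ioc (0 : ℝ) Rr) with hμ
  have hdwi : Integrable dw μ :=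
    (ContinuousOn.intervalIntegrable_of_Icc hR.le hdw).1
  have hpi : Integrable p μ := hp.1
  have hF : Integrable (fun z : ℝ × ℝ => {z : ℝ × ℝ | z.2 ≤ z.1}.indicator
      (fun z => dw z.1 * p z.2) z) (μ.prod μ) :=
    (hdwi.mul_prod hpi).indicator (measurableSet_le measurable_snd measurable_fst)
  have hsw := integral_integral_swap (μ := μ) (ν := μ)
    (f := fun t s => {z : ℝ × ℝ | z.2 ≤ z.1}.indicator (fun z => dw z.1 * p z.2) (t, s)) hF
  rw [intervalIntegral.integral_of_le hR.le, intervalIntegral.integral_of_le hR.le]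
  have e1 : ∫ t in Set.Ioc 0 Rr, dw t * ∫ s in (0 : ℝ)..t, p s =
      ∫ t, ∫ s, {z : ℝ × ℝ | z.2 ≤ z.1}.indicator (fun z => dw z.1 * p z.2) (t, s) ∂μ ∂μ := by
    refine setIntegral_congr_fun measurableSet_Ioc fun t ht => ?_
    have : (fun s => {z : ℝ × ℝ | z.2 ≤ z.1}.indicator (fun z => dw z.1 * p z.2) (t, s)) =
        (Set.Iic t).indicator (fun s => dw t * p s) := by
      ext s; simp [Set.indicator_apply]
    simp only [this]
    rw [integral_indicator measurableSet_Iic, hμ, Measure.restrict_restrict measurableSet_Iic,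
      intervalIntegral.integral_of_le ht.1.le, integral_const_mul]
    congr 3
    ext s; constructor
    · exact fun h => ⟨h.2, h.1, h.2.trans ht.2⟩
    · exact fun h => ⟨h.2.1, h.1⟩
  have e2 : ∫ s in Set.Ioc 0 Rr, (w Rr - w s) * p s =
      ∫ s, ∫ t, {z : ℝ × ℝ | z.2 ≤ z.1}.indicator (fun z => dw z.1 * p z.2) (t, s) ∂μ ∂μ := by
    refine setIntegral_congr_fun measurableSet_Ioc fun s hs => ?_
    have : (fun t => {z : ℝ × ℝ | z.2 ≤ z.1}.indicator (fun z => dw z.1 * p z.2) (t, s)) =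
        (Set.Ici s).indicator (fun t => dw t * p s) := by
      ext s; simp [Set.indicator_apply]
    simp only [this]
    rw [integral_indicator measurableSet_Ici, hμ, Measure.restrict_restrict measurableSet_Ici,
      integral_mul_const, ← integral_sub_of_hasDerivWithinAt hs.2
        (Set.Icc_subset_Icc_left hs.1.le) hw hdw, intervalIntegral.integral_of_le hs.2,
      ← integral_Icc_eq_integral_Ioc]
    congr 3
    ext t; constructor
    · exact fun h => ⟨h.1, hs.1.trans_le h.1, h.2⟩
    · exact fun h => ⟨h.1, h.2.2⟩
  rw [e1, e2, hsw]

lemma IsPrimitiveTwice.integral_mul {Rr : ℝ} (hR : 0 < Rr) {w dw g dg p : ℝ → ℂ}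
    (hg : IsPrimitiveTwice Rr g dg p)
    (hw : ∀ x ∈ Set.Icc (0 : ℝ) Rr, HasDerivWithinAt w (dw x) (Set.Icc (0 : ℝ) Rr) x)
    (hdw : ContinuousOn dw (Set.Icc 0 Rr)) :
    ∫ t in (0 : ℝ)..Rr, w t * p t =
      w Rr * dg Rr - w 0 * dg 0 - ∫ t in (0 : ℝ)..Rr, dw t * dg t := by
  have hwc : ContinuousOn w (Set.uIcc 0 Rr) := by
    rw [Set.uIcc_of_le hR.le]; exact fun x hx => (hw x hx).continuousWithinAt
  have h1 := integral_mul_primitive hR hw hdw hg.integrable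
  have hprim := intervalIntegral.continuousOn_primitive_interval' hg.integrable
    (Set.left_mem_uIcc (a := (0 : ℝ)) (b := Rr))
  have hdw' : ContinuousOn dw (Set.uIcc 0 Rr) := by rwa [Set.uIcc_of_le hR.le]
  have h2 : ∫ t in (0 : ℝ)..Rr, dw t * dg t =
      ∫ t in (0 : ℝ)..Rr, (dw t * dg 0 + dw t * ∫ s in (0 : ℝ)..t, p s) := by
    refine intervalIntegral.integral_congr fun t ht => ?_
    rw [Set.uIcc_of_le hR.le] at ht
    simp only [hg.eq_add_integral t ht]; ring
  have i1 : IntervalIntegrable (fun t => dw t * dg 0) volume 0 Rr :=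
    (hdw'.mul continuousOn_const).intervalIntegrable
  have i2 : IntervalIntegrable (fun t => dw t * ∫ s in (0 : ℝ)..t, p s) volume 0 Rr :=
    (hdw'.mul hprim).intervalIntegrable
  rw [h2, intervalIntegral.integral_add i1 i2, h1, intervalIntegral.integral_mul_const,
    integral_sub_of_hasDerivWithinAt hR.le subset_rfl hw hdw,
    hg.eq_add_integral Rr ⟨hR.le, le_rfl⟩]
  simp only [sub_mul]
  rw [intervalIntegral.integral_sub (hg.integrable.const_mul _)
    (hg.integrable.continuousOn_mul hwc), intervalIntegral.integral_const_mul]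
  ring

/-- Volterra's theorem: the initial value problem `g'' = q g - h` with `q, h ∈ L¹`. -/
lemma exists_isPrimitiveTwice {Rr : ℝ} (hR : 0 < Rr) {q h : ℝ → ℂ}
    (hq : IntervalIntegrable q volume 0 Rr) (hh : IntervalIntegrable h volume 0 Rr) (a b : ℂ) :
    ∃ g dg : ℝ → ℂ, IsPrimitiveTwice Rr g dg (fun t => q t * g t - h t) ∧ g 0 = a ∧ dg 0 = b := by
  -- the weight `exp (L x)` turns the Volterra map for `dg` into a contraction
  set Q : ℝ := ∫ t in (0 : ℝ)..Rr, ‖q t‖ with hQ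
  have hQ0 : 0 ≤ Q := intervalIntegral.integral_nonneg hR.le fun _ _ => norm_nonneg _
  set L : ℝ := 2 * Q + 1 with hL
  have hL0 : 0 < L := by positivity
  let X := C(Set.Icc (0 : ℝ) Rr, ℂ)
  let e : X → ℝ → ℂ := fun v t => (Real.exp (L * t) : ℂ) * Set.IccExtend hR.le v t
  have he : ∀ v, Continuous (e v) := fun v =>
    (Complex.continuous_ofReal.comp (Real.continuous_exp.comp (continuous_const.mul
      continuous_id))).mul v.continuous.Icc_extend'
  let U : X → ℝ → ℂ := fun v t => a + ∫ s in (0 : ℝ)..t, e v s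
  have hU : ∀ v, Continuous (U v) := fun v =>
    continuous_const.add (intervalIntegral.continuous_primitive
      (fun x y => (he v).intervalIntegrable x y) 0)
  have hI : ∀ v, IntervalIntegrable (fun t => q t * U v t - h t) volume 0 Rr := fun v =>
    (hq.mul_continuousOn (hU v).continuousOn).sub hh
  let P : X → ℝ → ℂ := fun v x => b + ∫ t in (0 : ℝ)..x, (q t * U v t - h t)
  have hP : ∀ v, ContinuousOn (P v) (Set.Icc 0 Rr) := fun v => by
    have h1 := intervalIntegral.continuousOn_primitive_interval' (hI v)
      (Set.left_mem_uIcc (a := (0 : ℝ)) (b := Rr))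
    rw [Set.uIcc_of_le hR.le] at h1
    exact continuousOn_const.add h1
  let Φ : X → X := fun v => ⟨fun x => (Real.exp (-(L * x)) : ℂ) * P v x,
    ((Complex.continuous_ofReal.comp (Real.continuous_exp.comp
      (continuous_const.mul continuous_subtype_val).neg)).mul
      (continuousOn_iff_continuous_domRestrict.1 (hP v)))⟩
  have hest : ∀ v w : X, ∀ t ∈ Set.Icc (0 : ℝ) Rr, ∀ x ∈ Set.Icc t Rr,
      ‖U v t - U w t‖ ≤ Real.exp (L * x) / L * dist v w := by
    intro v w t ht x hx
    have : U v t - U w t = ∫ s in (0 : ℝ)..t, (e v s - e w s) := by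
      simp only [U]
      rw [intervalIntegral.integral_sub ((he v).intervalIntegrable _ _)
        ((he w).intervalIntegrable _ _)]
      ring
    rw [this]
    have hb : ∀ s, ‖e v s - e w s‖ ≤ Real.exp (L * s) * dist v w := by
      intro s
      simp only [e, ← mul_sub, norm_mul]
      rw [Complex.norm_real, Real.norm_eq_abs, Real.abs_exp]
      refine mul_le_mul_of_nonneg_left ?_ (Real.exp_pos _).le
      rw [← dist_eq_norm]
      exact ContinuousMap.dist_apply_le_dist _
    have hint : ∫ s in (0 : ℝ)..t, Real.exp (L * s) = (Real.exp (L * t) - 1) / L := by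
      have := intervalIntegral.integral_comp_mul_left (a := 0) (b := t) Real.exp hL0.ne'
      rw [this]; simp; ring
    calc ‖∫ s in (0 : ℝ)..t, (e v s - e w s)‖
        ≤ ∫ s in (0 : ℝ)..t, Real.exp (L * s) * dist v w :=
          intervalIntegral.norm_integral_le_of_norm_le ht.1
            (Filter.Eventually.of_forall fun s _ => hb s)
            ((Continuous.mul (by fun_prop) continuous_const).intervalIntegrable _ _)
      _ = (Real.exp (L * t) - 1) / L * dist v w := by
          rw [intervalIntegral.integral_mul_const, hint]
      _ ≤ Real.exp (L * x) / L * dist v w := by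
          have : Real.exp (L * t) ≤ Real.exp (L * x) :=
            Real.exp_le_exp.2 (mul_le_mul_of_nonneg_left hx.1 hL0.le)
          gcongr
          linarith
  have hcontr : ContractingWith (1 / 2) Φ := by
    refine ⟨by norm_num, LipschitzWith.of_dist_le_mul fun v w => ?_⟩
    refine (ContinuousMap.dist_le (by positivity)).2 fun x => ?_
    have hx := x.2
    have hsub : Set.uIcc (0 : ℝ) x ⊆ Set.uIcc 0 Rr := by
      rw [Set.uIcc_of_le hx.1, Set.uIcc_of_le hR.le]; exact Set.Icc_subset_Icc_right hx.2
    have hPd : P v x - P w x = ∫ t in (0 : ℝ)..x, q t * (U v t - U w t) := by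
      simp only [P]
      rw [add_sub_add_left_eq_sub, ← intervalIntegral.integral_sub
        ((hI v).mono_set hsub) ((hI w).mono_set hsub)]
      exact intervalIntegral.integral_congr fun t _ => by ring
    have hqx : IntervalIntegrable q volume 0 x := hq.mono_set hsub
    have hle : ‖P v x - P w x‖ ≤ Q * (Real.exp (L * x) / L * dist v w) := by
      rw [hPd]
      calc ‖∫ t in (0 : ℝ)..x, q t * (U v t - U w t)‖
          ≤ ∫ t in (0 : ℝ)..x, ‖q t‖ * (Real.exp (L * x) / L * dist v w) := by
            refine intervalIntegral.norm_integral_le_of_norm_le hx.1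
              (Filter.Eventually.of_forall fun t ht => ?_) (hqx.norm.mul_const _)
            rw [norm_mul]
            exact mul_le_mul_of_nonneg_left
              (hest v w t ⟨ht.1.le, ht.2.trans hx.2⟩ x ⟨ht.2, hx.2⟩) (norm_nonneg _)
        _ ≤ Q * (Real.exp (L * x) / L * dist v w) := by
            rw [intervalIntegral.integral_mul_const]
            refine mul_le_mul_of_nonneg_right ?_ (by positivity)
            exact intervalIntegral.integral_mono_interval le_rfl hx.1 hx.2
              (Filter.Eventually.of_forall fun _ => norm_nonneg _) hq.norm
    have : dist (Φ v x) (Φ w x) = Real.exp (-(L * x)) * ‖P v x - P w x‖ := by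
      rw [dist_eq_norm]
      change ‖(Real.exp (-(L * x)) : ℂ) * P v x - (Real.exp (-(L * x)) : ℂ) * P w x‖ = _
      rw [← mul_sub, norm_mul, Complex.norm_real, Real.norm_eq_abs, Real.abs_exp]
    rw [this]
    calc Real.exp (-(L * x)) * ‖P v x - P w x‖
        ≤ Real.exp (-(L * x)) * (Q * (Real.exp (L * x) / L * dist v w)) := by gcongr
      _ = Q / L * dist v w := by
          rw [Real.exp_neg]; field_simp
      _ ≤ ((1 / 2 : NNReal) : ℝ) * dist v w := by
          refine mul_le_mul_of_nonneg_right ?_ dist_nonneg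
          rw [div_le_iff₀ hL0, hL]; push_cast; linarith
  have : Nonempty X := ⟨0⟩
  obtain ⟨v, hv⟩ : ∃ v, Φ v = v := ⟨_, hcontr.fixedPoint_isFixedPt⟩
  have hev : ∀ x ∈ Set.Icc (0 : ℝ) Rr, e v x = P v x := by
    intro x hx
    have h1 : Set.IccExtend hR.le v x = (Real.exp (-(L * x)) : ℂ) * P v x := by
      rw [Set.IccExtend_of_mem hR.le _ hx]
      exact (congrArg (fun f : X => f ⟨x, hx⟩) hv).symm
    simp only [e, h1]
    rw [← mul_assoc, ← Complex.ofReal_mul, ← Real.exp_add]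
    simp
  refine ⟨U v, e v, ⟨fun x _ => ?_, hI v, fun x hx => ?_⟩, by simp [U], ?_⟩
  · exact ((intervalIntegral.integral_hasDerivAt_right ((he v).intervalIntegrable _ _)
      ((he v).stronglyMeasurableAtFilter _ _) (he v).continuousAt).const_add a).hasDerivWithinAt
  · rw [hev x hx, hev 0 ⟨le_rfl, hR.le⟩]; simp [P]
  · rw [hev 0 ⟨le_rfl, hR.le⟩]; simp [P]

/-- One-dimensional Sobolev inequality with an arbitrarily small gradient term. -/
lemma norm_sq_le_of_hasDerivWithinAt {Rr : ℝ} (hR : 0 < Rr) {g dg : ℝ → ℂ}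
    (hg : ∀ x ∈ Set.Icc (0 : ℝ) Rr, HasDerivWithinAt g (dg x) (Set.Icc (0 : ℝ) Rr) x)
    (hdg : ContinuousOn dg (Set.Icc 0 Rr)) {ε : ℝ} (hε : 0 < ε) {x : ℝ}
    (hx : x ∈ Set.Icc (0 : ℝ) Rr) :
    ‖g x‖ ^ 2 ≤ ε * (∫ t in (0 : ℝ)..Rr, ‖dg t‖ ^ 2) +
      (1 / ε + 1 / Rr) * ∫ t in (0 : ℝ)..Rr, ‖g t‖ ^ 2 := by
  have hgc : ContinuousOn g (Set.Icc 0 Rr) := fun x hx => (hg x hx).continuousWithinAt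
  have hi1 : IntervalIntegrable (fun t => ‖dg t‖ ^ 2) volume 0 Rr :=
    (hdg.norm.pow 2).intervalIntegrable_of_Icc hR.le
  have hi2 : IntervalIntegrable (fun t => ‖g t‖ ^ 2) volume 0 Rr :=
    (hgc.norm.pow 2).intervalIntegrable_of_Icc hR.le
  have hi3 : IntervalIntegrable (fun t => ε * ‖dg t‖ ^ 2 + 1 / ε * ‖g t‖ ^ 2) volume 0 Rr :=
    (hi1.const_mul ε).add (hi2.const_mul (1 / ε))
  set E := ∫ t in (0 : ℝ)..Rr, (ε * ‖dg t‖ ^ 2 + 1 / ε * ‖g t‖ ^ 2) with hE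
  have key : ∀ y ∈ Set.Icc (0 : ℝ) Rr, ‖g x‖ ^ 2 ≤ ‖g y‖ ^ 2 + E := by
    intro y hy
    have hsub : Set.uIcc y x ⊆ Set.Icc 0 Rr := Set.uIcc_subset_Icc hy hx
    have hcont : ContinuousOn (fun t => 2 * inner ℝ (g t) (dg t)) (Set.Icc 0 Rr) :=
      continuousOn_const.mul (hgc.inner (𝕜 := ℝ) hdg)
    have h1 : ∫ t in y..x, 2 * inner ℝ (g t) (dg t) = ‖g x‖ ^ 2 - ‖g y‖ ^ 2 := by
      refine intervalIntegral.integral_eq_sub_of_hasDeriv_right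
        (f := fun t => ‖g t‖ ^ 2) ((hgc.norm.pow 2).mono hsub) (fun t ht => ?_)
        (hcont.mono hsub).intervalIntegrable
      have ht' : t ∈ Set.Ioo (0 : ℝ) Rr :=
        ⟨(le_min hy.1 hx.1).trans_lt ht.1, ht.2.trans_le (max_le hy.2 hx.2)⟩
      exact (((hg t (Set.Ioo_subset_Icc_self ht')).norm_sq).hasDerivAt
        (Icc_mem_nhds ht'.1 ht'.2)).hasDerivWithinAt
    have h2 : ‖∫ t in y..x, 2 * inner ℝ (g t) (dg t)‖ ≤ E := by
      refine intervalIntegral.norm_integral_le_integral_norm_uIoc.trans ?_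
      rw [hE, intervalIntegral.integral_of_le hR.le]
      have hsub' : Set.uIoc y x ⊆ Set.Ioc 0 Rr :=
        Set.Ioc_subset_Ioc (le_min hy.1 hx.1) (max_le hy.2 hx.2)
      refine (setIntegral_mono_on ?_ (hi3.1.mono_set hsub') measurableSet_uIoc
        fun t _ => ?_).trans (setIntegral_mono_set hi3.1 ?_ hsub'.eventuallyLE)
      · exact ((hcont.intervalIntegrable_of_Icc hR.le).1.mono_set hsub').norm
      · have h3 := norm_inner_le_norm (𝕜 := ℝ) (g t) (dg t)
        rw [norm_mul, Real.norm_two]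
        have h4 : 0 ≤ (ε * ‖dg t‖ - ‖g t‖) ^ 2 / ε := by positivity
        have h5 : (ε * ‖dg t‖ - ‖g t‖) ^ 2 / ε =
            ε * ‖dg t‖ ^ 2 + 1 / ε * ‖g t‖ ^ 2 - 2 * (‖g t‖ * ‖dg t‖) := by
          field_simp; ring
        linarith
      · exact Filter.Eventually.of_forall fun t => by simp only [Pi.zero_apply]; positivity
    rw [h1] at h2
    linarith [le_abs_self (‖g x‖ ^ 2 - ‖g y‖ ^ 2), Real.norm_eq_abs (‖g x‖ ^ 2 - ‖g y‖ ^ 2)]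
  have h1 : ∫ y in (0 : ℝ)..Rr, ‖g x‖ ^ 2 ≤ ∫ y in (0 : ℝ)..Rr, (‖g y‖ ^ 2 + E) :=
    intervalIntegral.integral_mono_on hR.le intervalIntegrable_const
      (hi2.add intervalIntegrable_const) key
  rw [intervalIntegral.integral_add hi2 intervalIntegrable_const] at h1
  simp only [intervalIntegral.integral_const, sub_zero, smul_eq_mul] at h1
  have hE' : E = ε * (∫ t in (0 : ℝ)..Rr, ‖dg t‖ ^ 2) +
      1 / ε * ∫ t in (0 : ℝ)..Rr, ‖g t‖ ^ 2 := by
    rw [hE, intervalIntegral.integral_add (hi1.const_mul ε) (hi2.const_mul (1 / ε))]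
    simp
  have h2 : ‖g x‖ ^ 2 ≤ (1 / Rr) * (∫ t in (0 : ℝ)..Rr, ‖g t‖ ^ 2) + E := by
    rw [← mul_le_mul_iff_right₀ hR]
    refine h1.trans_eq ?_
    field_simp
  rw [hE'] at h2
  linarith

open ComplexConjugate in
/-- Green's first identity. -/
lemma IsPrimitiveTwice.integral_conj_mul {Rr : ℝ} (hR : 0 < Rr) {w dw g dg p : ℝ → ℂ}
    (hg : IsPrimitiveTwice Rr g dg p)
    (hw : ∀ x ∈ Set.Icc (0 : ℝ) Rr, HasDerivWithinAt w (dw x) (Set.Icc (0 : ℝ) Rr) x)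
    (hdw : ContinuousOn dw (Set.Icc 0 Rr)) :
    ∫ t in (0 : ℝ)..Rr, conj (w t) * p t =
      conj (w Rr) * dg Rr - conj (w 0) * dg 0 - ∫ t in (0 : ℝ)..Rr, conj (dw t) * dg t :=
  hg.integral_mul hR (w := fun t => conj (w t)) (dw := fun t => conj (dw t))
    (fun x hx => (hw x hx).star) (Complex.continuous_conj.comp_continuousOn hdw)

lemma bdryC_zero_left {Rr t0 tR : ℝ} (h0 : Real.sin t0 ≠ 0) {u du : ℝ → ℂ} {c : Fin 2 → ℂ}
    (h : bdryC Rr t0 tR u du = c) :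
    du 0 = (c 0 - Real.cos t0 * u 0) / Real.sin t0 := by
  have h1 : ((Real.sin t0 : ℝ) : ℂ) ≠ 0 := by exact_mod_cast h0
  rw [eq_div_iff h1, ← h]
  simp only [bdryC, Matrix.cons_val_zero]
  push_cast; ring

lemma bdryC_zero_right {Rr t0 tR : ℝ} (hR : Real.sin tR ≠ 0) {u du : ℝ → ℂ} {c : Fin 2 → ℂ}
    (h : bdryC Rr t0 tR u du = c) :
    du Rr = (Real.cos tR * u Rr - c 1) / Real.sin tR := by
  have h1 : ((Real.sin tR : ℝ) : ℂ) ≠ 0 := by exact_mod_cast hR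
  rw [eq_div_iff h1, ← h]
  simp only [bdryC, Matrix.cons_val_one, Matrix.cons_val_fin_one]
  push_cast; ring

lemma IsPrimitiveTwice.intervalIntegrable_rhs {Rr : ℝ} (hR : 0 < Rr) {q g dg h : ℝ → ℂ}
    (hq : IntervalIntegrable q volume 0 Rr)
    (hg : IsPrimitiveTwice Rr g dg (fun t => q t * g t - h t)) :
    IntervalIntegrable h volume 0 Rr := by
  have h1 : IntervalIntegrable (fun t => q t * g t) volume 0 Rr :=
    hq.mul_continuousOn (by rw [Set.uIcc_of_le hR.le]; exact hg.continuousOn)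
  exact (h1.sub hg.integrable).congr fun t _ => by simp

open ComplexConjugate in
/-- The form of `H - z` is bounded below by the `H¹` norm for `z` sufficiently negative. -/
lemma exists_energy_bound {Rr : ℝ} (hR : 0 < Rr) {V : ℝ → ℝ}
    (hV : IntervalIntegrable V volume 0 Rr) {t0 tR : ℝ} (ht0 : Real.sin t0 ≠ 0)
    (htR : Real.sin tR ≠ 0) :
    ∃ z1 : ℝ, ∀ z : ℝ, z ≤ z1 → ∀ g dg h : ℝ → ℂ,
      IsPrimitiveTwice Rr g dg (fun t => ((V t : ℂ) - z) * g t - h t) →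
      bdryC Rr t0 tR g dg = 0 →
      (1 / 2) * (∫ t in (0 : ℝ)..Rr, ‖dg t‖ ^ 2) + ∫ t in (0 : ℝ)..Rr, ‖g t‖ ^ 2 ≤
        (∫ t in (0 : ℝ)..Rr, conj (g t) * h t).re := by
  set k0 := Real.cos t0 / Real.sin t0 with hk0
  set kR := Real.cos tR / Real.sin tR with hkR
  set K := (∫ t in (0 : ℝ)..Rr, |V t|) + |k0| + |kR| with hK
  have hV0 : 0 ≤ ∫ t in (0 : ℝ)..Rr, |V t| :=
    intervalIntegral.integral_nonneg hR.le fun _ _ => abs_nonneg _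
  have hK0 : 0 ≤ K := by positivity
  set ε := 1 / (2 * (K + 1)) with hε
  have hε0 : 0 < ε := by positivity
  refine ⟨-(K * (1 / ε + 1 / Rr) + 1), fun z hz g dg h hg hb => ?_⟩
  have hgc := hg.continuousOn
  have hdgc := hg.continuousOn_deriv hR
  have hgc' : ContinuousOn g (Set.uIcc 0 Rr) := by rwa [Set.uIcc_of_le hR.le]
  set D := ∫ t in (0 : ℝ)..Rr, ‖dg t‖ ^ 2 with hD
  set N := ∫ t in (0 : ℝ)..Rr, ‖g t‖ ^ 2 with hN
  have hD0 : 0 ≤ D := intervalIntegral.integral_nonneg hR.le fun _ _ => by positivity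
  have hN0 : 0 ≤ N := intervalIntegral.integral_nonneg hR.le fun _ _ => by positivity
  set M := ε * D + (1 / ε + 1 / Rr) * N with hM
  have hsup : ∀ x ∈ Set.Icc (0 : ℝ) Rr, ‖g x‖ ^ 2 ≤ M := fun x hx =>
    norm_sq_le_of_hasDerivWithinAt hR hg.hasDeriv hdgc hε0 hx
  have hVc : IntervalIntegrable (fun t => (V t : ℂ)) volume 0 Rr := ⟨hV.1.ofReal, hV.2.ofReal⟩
  have hqc : IntervalIntegrable (fun t => (V t : ℂ) - z) volume 0 Rr :=
    hVc.sub intervalIntegrable_const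
  have hh := hg.intervalIntegrable_rhs hR hqc
  have hi2 : IntervalIntegrable (fun t => ‖g t‖ ^ 2) volume 0 Rr :=
    (hgc.norm.pow 2).intervalIntegrable_of_Icc hR.le
  have hi4 : IntervalIntegrable (fun t => V t * ‖g t‖ ^ 2) volume 0 Rr :=
    hV.mul_continuousOn (hgc'.norm.pow 2)
  have hconj : ContinuousOn (fun t => conj (g t)) (Set.uIcc 0 Rr) :=
    Complex.continuous_conj.comp_continuousOn hgc'
  have hgreen := hg.integral_conj_mul hR hg.hasDeriv hdgc
  have hnsq : ∀ w : ℂ, conj w * w = ((‖w‖ ^ 2 : ℝ) : ℂ) := fun w => by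
    rw [Complex.conj_mul']; push_cast; rfl
  have e1 : ∫ t in (0 : ℝ)..Rr, conj (g t) * (((V t : ℂ) - z) * g t - h t) =
      (((∫ t in (0 : ℝ)..Rr, V t * ‖g t‖ ^ 2) - z * N : ℝ) : ℂ) -
        ∫ t in (0 : ℝ)..Rr, conj (g t) * h t := by
    rw [hN, ← intervalIntegral.integral_const_mul, ← intervalIntegral.integral_sub hi4
      (hi2.const_mul z), ← intervalIntegral.integral_ofReal,
      ← intervalIntegral.integral_sub]
    · refine intervalIntegral.integral_congr fun t _ => ?_
      have := hnsq (g t)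
      simp only [Complex.ofReal_sub, Complex.ofReal_mul, ← this]
      ring
    · exact ⟨(hi4.sub (hi2.const_mul z)).1.ofReal, (hi4.sub (hi2.const_mul z)).2.ofReal⟩
    · exact hh.continuousOn_mul hconj
  have e2 : ∫ t in (0 : ℝ)..Rr, conj (dg t) * dg t = ((D : ℝ) : ℂ) := by
    rw [hD, ← intervalIntegral.integral_ofReal]
    exact intervalIntegral.integral_congr fun t _ => hnsq (dg t)
  have e3 : conj (g 0) * dg 0 = ((-k0 * ‖g 0‖ ^ 2 : ℝ) : ℂ) := by
    rw [bdryC_zero_left ht0 hb, Complex.ofReal_mul, ← hnsq, hk0]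
    push_cast; simp; ring
  have e4 : conj (g Rr) * dg Rr = ((kR * ‖g Rr‖ ^ 2 : ℝ) : ℂ) := by
    rw [bdryC_zero_right htR hb, Complex.ofReal_mul, ← hnsq, hkR]
    push_cast; simp; ring
  rw [e1, e2, e3, e4] at hgreen
  have hre := congrArg Complex.re hgreen
  simp only [Complex.sub_re, Complex.ofReal_re] at hre
  have b1 : |∫ t in (0 : ℝ)..Rr, V t * ‖g t‖ ^ 2| ≤ (∫ t in (0 : ℝ)..Rr, |V t|) * M := by
    rw [← intervalIntegral.integral_mul_const, ← Real.norm_eq_abs]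
    refine intervalIntegral.norm_integral_le_of_norm_le hR.le
      (Filter.Eventually.of_forall fun t ht => ?_) (hV.norm.mul_const M)
    rw [norm_mul, Real.norm_eq_abs, Real.norm_of_nonneg (sq_nonneg ‖g t‖)]
    exact mul_le_mul_of_nonneg_left (hsup t ⟨ht.1.le, ht.2⟩) (abs_nonneg _)
  have b2 : |k0 * ‖g 0‖ ^ 2| ≤ |k0| * M := by
    rw [abs_mul, abs_of_nonneg (sq_nonneg ‖g 0‖)]
    exact mul_le_mul_of_nonneg_left (hsup 0 ⟨le_rfl, hR.le⟩) (abs_nonneg _)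
  have b3 : |kR * ‖g Rr‖ ^ 2| ≤ |kR| * M := by
    rw [abs_mul, abs_of_nonneg (sq_nonneg ‖g Rr‖)]
    exact mul_le_mul_of_nonneg_left (hsup Rr ⟨hR.le, le_rfl⟩) (abs_nonneg _)
  have b4 : K * M ≤ (1 / 2) * D + K * (1 / ε + 1 / Rr) * N := by
    have : K * ε ≤ 1 / 2 := by
      rw [hε, mul_one_div, div_le_iff₀ (by positivity)]; linarith
    have := mul_le_mul_of_nonneg_right this hD0
    rw [hM]; linarith
  have b5 : (K * (1 / ε + 1 / Rr) + 1) * N ≤ -z * N :=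
    mul_le_mul_of_nonneg_right (by linarith) hN0
  have b6 : K * M = (∫ t in (0 : ℝ)..Rr, |V t|) * M + |k0| * M + |kR| * M := by
    rw [hK]; ring
  have a1 := (abs_le.1 b1).1
  have a2 := (abs_le.1 b2).2
  have a3 := (abs_le.1 b3).2
  linarith

namespace IsPrimitiveTwice

lemma congr {Rr : ℝ} {g dg p p' : ℝ → ℂ} (h : IsPrimitiveTwice Rr g dg p) (hp : ∀ t, p t = p' t) :
    IsPrimitiveTwice Rr g dg p' := by
  rwa [← funext hp]

lemma add_smul {Rr : ℝ} {g dg p g' dg' p' : ℝ → ℂ} (h : IsPrimitiveTwice Rr g dg p)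
    (h' : IsPrimitiveTwice Rr g' dg' p') (c : ℂ) :
    IsPrimitiveTwice Rr (fun t => g t + c * g' t) (fun t => dg t + c * dg' t)
      (fun t => p t + c * p' t) := by
  refine ⟨fun x hx => (h.hasDeriv x hx).add ((h'.hasDeriv x hx).const_mul c),
    h.integrable.add (h'.integrable.const_mul c), fun x hx => ?_⟩
  have hsub : Set.uIcc (0 : ℝ) x ⊆ Set.uIcc 0 Rr := by
    rw [Set.uIcc_of_le hx.1, Set.uIcc_of_le (hx.1.trans hx.2)]
    exact Set.Icc_subset_Icc_right hx.2
  rw [intervalIntegral.integral_add (h.integrable.mono_set hsub)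
    ((h'.integrable.mono_set hsub).const_mul c), intervalIntegral.integral_const_mul,
    h.eq_add_integral x hx, h'.eq_add_integral x hx]
  ring

end IsPrimitiveTwice

lemma bdryC_add_smul (Rr : ℝ) (t0 tR : ℂ) (g dg g' dg' : ℝ → ℂ) (c : ℂ) :
    bdryC Rr t0 tR (fun t => g t + c * g' t) (fun t => dg t + c * dg' t) =
      bdryC Rr t0 tR g dg + c • bdryC Rr t0 tR g' dg' := by
  ext i
  fin_cases i <;> simp [bdryC] <;> ring

/-- Unique solvability of the homogeneous problem yields solvability of the boundary value
problem. -/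
lemma exists_boundary_value_solution {Rr : ℝ} (hR : 0 < Rr) {q : ℝ → ℂ}
    (hq : IntervalIntegrable q volume 0 Rr) (t0 tR : ℂ)
    (hinj : ∀ g dg : ℝ → ℂ, IsPrimitiveTwice Rr g dg (fun t => q t * g t) →
      bdryC Rr t0 tR g dg = 0 → g 0 = 0 ∧ dg 0 = 0)
    {h : ℝ → ℂ} (hh : IntervalIntegrable h volume 0 Rr) (c : Fin 2 → ℂ) :
    ∃ g dg : ℝ → ℂ, IsPrimitiveTwice Rr g dg (fun t => q t * g t - h t) ∧
      bdryC Rr t0 tR g dg = c := by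
  have hz : IntervalIntegrable (fun _ : ℝ => (0 : ℂ)) volume 0 Rr := intervalIntegrable_const
  obtain ⟨g, dg, hg, -, -⟩ := exists_isPrimitiveTwice hR hq hh 0 0
  obtain ⟨u, du, hu, hu0, hdu0⟩ := exists_isPrimitiveTwice hR hq hz 1 0
  obtain ⟨v, dv, hv, hv0, hdv0⟩ := exists_isPrimitiveTwice hR hq hz 0 1
  let T : (Fin 2 → ℂ) →ₗ[ℂ] (Fin 2 → ℂ) :=
    (LinearMap.proj 0).smulRight (bdryC Rr t0 tR u du) +
      (LinearMap.proj 1).smulRight (bdryC Rr t0 tR v dv)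
  have hT : ∀ a, T a = a 0 • bdryC Rr t0 tR u du + a 1 • bdryC Rr t0 tR v dv := fun a => rfl
  have hTinj : Function.Injective T := by
    rw [injective_iff_map_eq_zero]
    intro a ha
    have hzero : IsPrimitiveTwice Rr (fun _ => 0) (fun _ => 0) (fun _ => 0) :=
      ⟨fun x _ => hasDerivWithinAt_const _ _ _, hz, fun x _ => by simp⟩
    have h2 := (hzero.add_smul hu (a 0)).add_smul hv (a 1)
    have h3 := hinj _ _ (h2.congr fun t => by ring) (by
      rw [bdryC_add_smul, bdryC_add_smul]
      have : bdryC Rr t0 tR (fun _ => 0) (fun _ => 0) = 0 := by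
        ext i; fin_cases i <;> simp [bdryC]
      rw [this, zero_add, ← hT, ha])
    simp only [hu0, hdu0, hv0, hdv0] at h3
    ext i
    fin_cases i
    · simpa using h3.1
    · simpa using h3.2
  obtain ⟨a, ha⟩ := LinearMap.injective_iff_surjective.1 hTinj (c - bdryC Rr t0 tR g dg)
  refine ⟨_, _, ((hg.add_smul hu (a 0)).add_smul hv (a 1)).congr fun t => by ring, ?_⟩
  rw [bdryC_add_smul, bdryC_add_smul, add_assoc, ← hT, ha]
  simp

lemma intervalIntegrable_iff_integrable_restrict_Ioo {E : Type*} [NormedAddCommGroup E] {Rr : ℝ}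
    (hR : 0 < Rr) {f : ℝ → E} :
    IntervalIntegrable f volume 0 Rr ↔ Integrable f (volume.restrict (Set.Ioo 0 Rr)) :=
  intervalIntegrable_iff_integrableOn_Ioo_of_le hR.le

lemma SchSp.intervalIntegrable {Rr : ℝ} (hR : 0 < Rr) (h : SchSp Rr) {h0 : ℝ → ℂ}
    (he : ∀ᵐ x ∂(volume.restrict (Set.Ioo (0 : ℝ) Rr)), h x = h0 x) :
    IntervalIntegrable h0 volume 0 Rr := by
  rw [intervalIntegrable_iff_integrable_restrict_Ioo hR]
  exact ((Lp.memLp h).integrable one_le_two).congr he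

open ComplexConjugate in
lemma SchSp.inner_eq {Rr : ℝ} (hR : 0 < Rr) (f h : SchSp Rr) {f0 h0 : ℝ → ℂ}
    (hf : ∀ᵐ x ∂(volume.restrict (Set.Ioo (0 : ℝ) Rr)), f x = f0 x)
    (hh : ∀ᵐ x ∂(volume.restrict (Set.Ioo (0 : ℝ) Rr)), h x = h0 x) :
    ⟪f, h⟫_ℂ = ∫ t in (0 : ℝ)..Rr, conj (f0 t) * h0 t := by
  rw [L2.inner_def, intervalIntegral.integral_of_le hR.le, integral_Ioc_eq_integral_Ioo]
  refine integral_congr_ae ?_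
  filter_upwards [hf, hh] with x h1 h2
  rw [h1, h2, RCLike.inner_apply, mul_comm]

open ComplexConjugate in
lemma SchSp.norm_sq_eq {Rr : ℝ} (hR : 0 < Rr) (f : SchSp Rr) {f0 : ℝ → ℂ}
    (hf : ∀ᵐ x ∂(volume.restrict (Set.Ioo (0 : ℝ) Rr)), f x = f0 x) :
    ‖f‖ ^ 2 = ∫ t in (0 : ℝ)..Rr, ‖f0 t‖ ^ 2 := by
  have h1 := SchSp.inner_eq hR f f hf hf
  rw [inner_self_eq_norm_sq_to_K] at h1
  have h2 : ∫ t in (0 : ℝ)..Rr, conj (f0 t) * f0 t =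
      ((∫ t in (0 : ℝ)..Rr, ‖f0 t‖ ^ 2 : ℝ) : ℂ) := by
    rw [← intervalIntegral.integral_ofReal]
    refine intervalIntegral.integral_congr fun t _ => ?_
    simp only [Complex.conj_mul']; push_cast; rfl
  rw [h2] at h1
  exact Complex.ofReal_injective (by simpa using h1)

lemma SchSp.exists_of_continuousOn {Rr : ℝ} {g : ℝ → ℂ} (hg : ContinuousOn g (Set.Icc 0 Rr)) :
    ∃ f : SchSp Rr, ∀ᵐ x ∂(volume.restrict (Set.Ioo (0 : ℝ) Rr)), f x = g x := by
  obtain ⟨C, hC⟩ := isCompact_Icc.exists_bound_of_continuousOn hg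
  have hm : MemLp g 2 (volume.restrict (Set.Ioo (0 : ℝ) Rr)) :=
    MemLp.of_bound ((hg.mono Set.Ioo_subset_Icc_self).aestronglyMeasurable measurableSet_Ioo) C
      ((ae_restrict_iff' measurableSet_Ioo).2 (Filter.Eventually.of_forall fun x hx =>
        hC x (Set.Ioo_subset_Icc_self hx)))
  exact ⟨hm.toLp g, hm.coeFn_toLp⟩

lemma SolvesAt.exists_isPrimitiveTwice {Rr : ℝ} (hR : 0 < Rr) {V : ℝ → ℂ}
    (hV : IntervalIntegrable V volume 0 Rr) {z : ℂ} {f h : SchSp Rr} {g dg : ℝ → ℂ}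
    (hs : SolvesAt Rr V z f h g dg) :
    ∃ h0 : ℝ → ℂ, (∀ᵐ x ∂(volume.restrict (Set.Ioo (0 : ℝ) Rr)), h x = h0 x) ∧
      IsPrimitiveTwice Rr g dg (fun t => (V t - z) * g t - h0 t) := by
  obtain ⟨-, hd, h0, hh, hi⟩ := hs
  have hgc : ContinuousOn g (Set.uIcc 0 Rr) := by
    rw [Set.uIcc_of_le hR.le]; exact fun x hx => (hd x hx).continuousWithinAt
  refine ⟨h0, hh, hd, ((hV.sub intervalIntegrable_const).mul_continuousOn hgc).sub
    (SchSp.intervalIntegrable hR h hh), fun x hx => ?_⟩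
  rw [hi x hx]
  simp only [sub_mul]

lemma IsPrimitiveTwice.solvesAt {Rr : ℝ} {V : ℝ → ℂ} {z : ℂ} {f h : SchSp Rr}
    {g dg h0 : ℝ → ℂ} (hg : IsPrimitiveTwice Rr g dg (fun t => (V t - z) * g t - h0 t))
    (hf : ∀ᵐ x ∂(volume.restrict (Set.Ioo (0 : ℝ) Rr)), f x = g x)
    (hh : ∀ᵐ x ∂(volume.restrict (Set.Ioo (0 : ℝ) Rr)), h x = h0 x) :
    SolvesAt Rr V z f h g dg := by
  refine ⟨hf, hg.hasDeriv, h0, hh, fun x hx => ?_⟩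
  rw [hg.eq_add_integral x hx]
  simp only [sub_mul]

lemma SolvesAt.shift {Rr : ℝ} {V : ℝ → ℂ} {z : ℂ} (w : ℂ) {f h : SchSp Rr} {g dg : ℝ → ℂ}
    (hs : SolvesAt Rr V z f h g dg) : SolvesAt Rr V (z + w) f (h - w • f) g dg := by
  obtain ⟨hf, hd, h0, hh, hi⟩ := hs
  refine ⟨hf, hd, fun t => h0 t - w * g t, ?_, fun x hx => ?_⟩
  · filter_upwards [hf, hh, Lp.coeFn_sub h (w • f), Lp.coeFn_smul w f] with x h1 h2 h3 h4
    rw [h3, Pi.sub_apply, h4, Pi.smul_apply, h1, h2, smul_eq_mul]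
  · rw [hi x hx]
    congr 2 with t
    ring

lemma IsSchrodingerOp.mem_graph_iff {Rr : ℝ} {V : ℝ → ℂ} {t0 tR : ℂ}
    {A : SchSp Rr →ₗ.[ℂ] SchSp Rr} (hA : IsSchrodingerOp Rr V t0 tR A) (z : ℂ) (f h : SchSp Rr) :
    (f, h + z • f) ∈ A.graph ↔
      ∃ g dg : ℝ → ℂ, SolvesAt Rr V z f h g dg ∧ bdryC Rr t0 tR g dg = 0 := by
  rw [hA]
  constructor
  · rintro ⟨g, dg, hs, hb⟩
    exact ⟨g, dg, by simpa using hs.shift z, hb⟩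
  · rintro ⟨g, dg, hs, hb⟩
    exact ⟨g, dg, by simpa using hs.shift (-z), hb⟩

lemma res_isResolvent {E : Type*} [NormedAddCommGroup E] [InnerProductSpace ℂ E]
    {A : E →ₗ.[ℂ] E} {z : ℂ} (hz : z ∈ resolventSetP A) :
    IsResolvent A z (res A z) := by
  have h : ∃ T, IsResolvent A z T := hz
  rw [res, dif_pos h]
  exact h.choose_spec

lemma IsResolvent.mem_graph {E : Type*} [NormedAddCommGroup E] [InnerProductSpace ℂ E]
    {A : E →ₗ.[ℂ] E} {z : ℂ} {T : E →L[ℂ] E} (hT : IsResolvent A z T)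
    (h : E) : (T h, h + z • T h) ∈ A.graph := by
  obtain ⟨hx, he⟩ := hT.1 h
  rw [LinearPMap.mem_graph_iff]
  exact ⟨⟨T h, hx⟩, rfl, by rw [← sub_eq_iff_eq_add]; exact he⟩

lemma IsResolvent.injective {E : Type*} [NormedAddCommGroup E] [InnerProductSpace ℂ E]
    {A : E →ₗ.[ℂ] E} {z : ℂ} {T : E →L[ℂ] E} (hT : IsResolvent A z T) :
    Function.Injective T := by
  rw [injective_iff_map_eq_zero]
  intro h hh
  have h1 := hT.mem_graph h
  rw [hh] at h1
  simpa using A.graph_fst_eq_zero_snd h1 rfl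

/-- An operator whose shift by `-z` is bijective with `‖f‖ ≤ ‖(A - z) f‖` has `z` in its
resolvent set. -/
lemma mem_resolventSetP_of_bound {E : Type*} [NormedAddCommGroup E] [InnerProductSpace ℂ E]
    {A : E →ₗ.[ℂ] E} {z : ℂ}
    (hex : ∀ h : E, ∃ f : E, (f, h + z • f) ∈ A.graph)
    (hbd : ∀ f h : E, (f, h + z • f) ∈ A.graph → ‖f‖ ≤ ‖h‖) : z ∈ resolventSetP A := by
  choose S hS using hex
  have huniq : ∀ f h, (f, h + z • f) ∈ A.graph → f = S h := by
    intro f h hf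
    have h1 := A.graph.sub_mem hf (hS h)
    have h2 := hbd (f - S h) 0 (by
      convert h1 using 1
      simp only [Prod.mk_sub_mk, Prod.mk.injEq, true_and, smul_sub]; abel)
    rw [norm_zero, norm_le_zero_iff, sub_eq_zero] at h2
    exact h2
  let T : E →ₗ[ℂ] E :=
    { toFun := S
      map_add' := fun x y => (huniq _ _ (by
        convert A.graph.add_mem (hS x) (hS y) using 1
        simp only [Prod.mk_add_mk, Prod.mk.injEq, true_and, smul_add]; abel)).symm
      map_smul' := fun c x => (huniq _ _ (by
        convert A.graph.smul_mem c (hS x) using 1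
        simp only [RingHom.id_apply, Prod.smul_mk, Prod.mk.injEq, true_and, smul_add]
        rw [smul_comm c z])).symm }
  refine ⟨T.mkContinuous 1 fun x => by rw [one_mul]; exact hbd _ _ (hS x), fun x => ?_, fun u => ?_⟩
  · obtain ⟨y, h1, h2⟩ := A.mem_graph_iff.1 (hS x)
    have h1' : (y : E) = S x := h1
    have h2' : A y = x + z • S x := h2
    have hmem : S x ∈ A.domain := h1' ▸ y.2
    refine ⟨hmem, ?_⟩
    have : (⟨S x, hmem⟩ : A.domain) = y := Subtype.ext h1'.symm
    change A ⟨S x, hmem⟩ - z • S x = x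
    rw [this, h2']; simp
  · refine (huniq _ _ ?_).symm
    rw [sub_add_cancel]
    exact A.mem_graph u

open ComplexConjugate in
lemma IsPrimitiveTwice.conj {Rr : ℝ} {g dg p : ℝ → ℂ} (hg : IsPrimitiveTwice Rr g dg p) :
    IsPrimitiveTwice Rr (fun t => conj (g t)) (fun t => conj (dg t)) (fun t => conj (p t)) := by
  have hp : IntervalIntegrable (fun t => conj (p t)) volume 0 Rr :=
    ⟨(LinearIsometryEquiv.integrable_comp_iff Complex.conjLIE).2 hg.integrable.1,
      (LinearIsometryEquiv.integrable_comp_iff Complex.conjLIE).2 hg.integrable.2⟩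
  refine ⟨fun x hx => (hg.hasDeriv x hx).star, hp, fun x hx => ?_⟩
  simp only [hg.eq_add_integral x hx, map_add]
  rw [intervalIntegral.intervalIntegral_conj]

/-- Lagrange's identity. -/
lemma IsPrimitiveTwice.lagrange {Rr : ℝ} (hR : 0 < Rr) {q u du g dg h : ℝ → ℂ}
    (hq : IntervalIntegrable q volume 0 Rr)
    (hu : IsPrimitiveTwice Rr u du (fun t => q t * u t))
    (hg : IsPrimitiveTwice Rr g dg (fun t => q t * g t - h t)) :
    ∫ t in (0 : ℝ)..Rr, u t * h t =
      (g Rr * du Rr - g 0 * du 0) - (u Rr * dg Rr - u 0 * dg 0) := by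
  have h1 := hg.integral_mul hR hu.hasDeriv (hu.continuousOn_deriv hR)
  have h2 := hu.integral_mul hR hg.hasDeriv (hg.continuousOn_deriv hR)
  have hgc : ContinuousOn g (Set.uIcc 0 Rr) := by
    rw [Set.uIcc_of_le hR.le]; exact hg.continuousOn
  have huc : ContinuousOn u (Set.uIcc 0 Rr) := by
    rw [Set.uIcc_of_le hR.le]; exact hu.continuousOn
  have h3 : ∫ t in (0 : ℝ)..Rr, u t * (q t * g t - h t) =
      (∫ t in (0 : ℝ)..Rr, g t * (q t * u t)) - ∫ t in (0 : ℝ)..Rr, u t * h t := by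
    rw [← intervalIntegral.integral_sub (hu.integrable.continuousOn_mul hgc)
      ((hg.intervalIntegrable_rhs hR hq).continuousOn_mul huc)]
    exact intervalIntegral.integral_congr fun t _ => by ring
  have h4 : ∫ t in (0 : ℝ)..Rr, du t * dg t = ∫ t in (0 : ℝ)..Rr, dg t * du t :=
    intervalIntegral.integral_congr fun t _ => mul_comm _ _
  rw [h3, h2, h4] at h1
  linear_combination -h1

/-- On functions satisfying the primed boundary condition, the trace `γ` is a multiple of the
point evaluation. -/
lemma bdryC_eq_of_bdryC_eq {Rr t0 tR t0' tR' : ℝ} (h0 : Real.sin t0' ≠ 0)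
    (hR : Real.sin tR' ≠ 0) {u du : ℝ → ℂ} {c : Fin 2 → ℂ}
    (h : bdryC Rr t0' tR' u du = c) (i : Fin 2) :
    bdryC Rr t0 tR u du i =
      -((![Real.sin (t0 - t0'), Real.sin (tR - tR')] i : ℝ) : ℂ) /
        ((![Real.sin t0', Real.sin tR'] i : ℝ) : ℂ) * u (![0, Rr] i) +
      ((![Real.sin t0, Real.sin tR] i : ℝ) : ℂ) /
        ((![Real.sin t0', Real.sin tR'] i : ℝ) : ℂ) * c i := by
  have e0 := bdryC_zero_left h0 h
  have e1 := bdryC_zero_right hR h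
  have h0' : Complex.sin t0' ≠ 0 := by exact_mod_cast h0
  have hR' : Complex.sin tR' ≠ 0 := by exact_mod_cast hR
  fin_cases i
  · simp [bdryC, e0, Complex.sin_sub]
    field_simp; ring
  · simp [bdryC, e1, Complex.sin_sub]
    field_simp; ring

open ComplexConjugate in
/-- Pairing a solution of the homogeneous equation having real boundary data `c` with a function
in the range of the resolvent. -/
lemma IsPrimitiveTwice.integral_conj_mul_rhs {Rr : ℝ} (hR : 0 < Rr) {V : ℝ → ℝ}
    (hV : IntervalIntegrable (fun t => (V t : ℂ)) volume 0 Rr) {z t0 tR : ℝ}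
    (h0 : Real.sin t0 ≠ 0) (hR' : Real.sin tR ≠ 0) {u du g dg h : ℝ → ℂ} {c : Fin 2 → ℝ}
    (hu : IsPrimitiveTwice Rr u du (fun t => ((V t : ℂ) - z) * u t))
    (hbu : bdryC Rr t0 tR u du = fun i => (c i : ℂ))
    (hg : IsPrimitiveTwice Rr g dg (fun t => ((V t : ℂ) - z) * g t - h t))
    (hbg : bdryC Rr t0 tR g dg = 0) :
    ∫ t in (0 : ℝ)..Rr, conj (u t) * h t =
      -(c 0 : ℂ) / (Real.sin t0 : ℝ) * g 0 + -(c 1 : ℂ) / (Real.sin tR : ℝ) * g Rr := by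
  rw [(hu.conj.congr (p' := fun t => ((V t : ℂ) - z) * conj (u t)) fun t => by simp).lagrange hR
    (hV.sub intervalIntegrable_const) hg, bdryC_zero_left h0 hbg, bdryC_zero_right hR' hbg,
    bdryC_zero_left h0 hbu, bdryC_zero_right hR' hbu]
  have h0' : ((Real.sin t0 : ℝ) : ℂ) ≠ 0 := by exact_mod_cast h0
  have hR'' : ((Real.sin tR : ℝ) : ℂ) ≠ 0 := by exact_mod_cast hR'
  simp only [map_div₀, map_sub, map_mul, Complex.conj_ofReal, Pi.zero_apply]
  field_simp
  ring

/-- Convergence in `L²` with bounded derivatives in `L²` implies pointwise convergence. -/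
lemma tendsto_apply_of_integral_sq_deriv_le {Rr : ℝ} (hR : 0 < Rr) {w dw : ℕ → ℝ → ℂ}
    (hw : ∀ n, ∀ x ∈ Set.Icc (0 : ℝ) Rr,
      HasDerivWithinAt (w n) (dw n x) (Set.Icc (0 : ℝ) Rr) x)
    (hdw : ∀ n, ContinuousOn (dw n) (Set.Icc 0 Rr)) {M : ℝ}
    (hM : ∀ n, ∫ t in (0 : ℝ)..Rr, ‖dw n t‖ ^ 2 ≤ M)
    (h0 : Tendsto (fun n => ∫ t in (0 : ℝ)..Rr, ‖w n t‖ ^ 2) atTop (nhds 0))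
    {x : ℝ} (hx : x ∈ Set.Icc (0 : ℝ) Rr) : Tendsto (fun n => w n x) atTop (nhds 0) := by
  have hM0 : 0 ≤ M :=
    (intervalIntegral.integral_nonneg hR.le fun _ _ => by positivity).trans (hM 0)
  rw [tendsto_zero_iff_norm_tendsto_zero, Metric.tendsto_atTop']
  intro η hη
  set ε := η ^ 2 / (2 * (M + 1)) with hε
  have hε0 : 0 < ε := by positivity
  have h1 := (h0.const_mul (1 / ε + 1 / Rr))
  rw [mul_zero] at h1
  obtain ⟨n0, hn0⟩ := eventually_atTop.1 (h1.eventually_lt_const (show 0 < η ^ 2 / 2 by positivity))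
  refine ⟨n0, fun n hn => ?_⟩
  have h2 := norm_sq_le_of_hasDerivWithinAt hR (hw n) (hdw n) hε0 hx
  have h3 := hn0 n hn.le
  have h4 : ε * (∫ t in (0 : ℝ)..Rr, ‖dw n t‖ ^ 2) ≤ η ^ 2 / 2 := by
    refine (mul_le_mul_of_nonneg_left (hM n) hε0.le).trans ?_
    rw [hε, div_mul_eq_mul_div, div_le_div_iff₀ (by positivity) (by norm_num)]
    nlinarith [sq_nonneg η]
  rw [dist_zero_right, norm_norm]
  exact lt_of_pow_lt_pow_left₀ 2 hη.le (by linarith)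

lemma denseRange_of_symmetric_of_injective {E : Type*} [NormedAddCommGroup E]
    [InnerProductSpace ℂ E] [CompleteSpace E] {N : E →L[ℂ] E}
    (hsymm : ∀ v w, ⟪N v, w⟫_ℂ = ⟪v, N w⟫_ℂ) (hinj : Function.Injective N) : DenseRange N := by
  have hadj : ContinuousLinearMap.adjoint N = N :=
    ((ContinuousLinearMap.eq_adjoint_iff N N).2 hsymm).symm
  have h1 : (LinearMap.range N.toLinearMap)ᗮ = ⊥ := by
    have := ContinuousLinearMap.orthogonal_range N
    rw [hadj] at this
    rw [this]
    exact LinearMap.ker_eq_bot.2 hinj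
  have h2 := (Submodule.topologicalClosure_eq_top_iff).2 h1
  have h3 := congrArg (fun S : Submodule ℂ E => (S : Set E)) h2
  simp only [Submodule.topologicalClosure_coe, Submodule.top_coe] at h3
  exact dense_iff_closure_eq.2 h3

open ComplexConjugate in
/-- Let `N = (A - z)^{-1/2}` and let `b` be such that `N b` is represented by a `C¹` function `u`.
If `⟪N b', h⟫ = α g(x)` for every `g = (A - z)⁻¹ h`, then `⟪b', b⟫ = α u(x)`. -/
lemma IsSchrodingerOp.inner_eq_mul_apply {Rr : ℝ} (hR : 0 < Rr) {V : ℝ → ℝ}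
    (hV : IntervalIntegrable (fun t => (V t : ℂ)) volume 0 Rr) {t0 tR z : ℝ}
    {A : SchSp Rr →ₗ.[ℂ] SchSp Rr} (hA : IsSchrodingerOp Rr (fun t => (V t : ℂ)) t0 tR A)
    (hE : ∀ g dg h : ℝ → ℂ,
      IsPrimitiveTwice Rr g dg (fun t => ((V t : ℂ) - z) * g t - h t) →
      bdryC Rr t0 tR g dg = 0 →
      (1 / 2) * (∫ t in (0 : ℝ)..Rr, ‖dg t‖ ^ 2) + ∫ t in (0 : ℝ)..Rr, ‖g t‖ ^ 2 ≤
        (∫ t in (0 : ℝ)..Rr, conj (g t) * h t).re)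
    (hz : (z : ℂ) ∈ resolventSetP A) {N : SchSp Rr →L[ℂ] SchSp Rr}
    (hsymm : ∀ v w, ⟪N v, w⟫_ℂ = ⟪v, N w⟫_ℂ) (hNN : N.comp N = res A z)
    {b b' : SchSp Rr} {u du : ℝ → ℂ}
    (hu : ∀ x ∈ Set.Icc (0 : ℝ) Rr, HasDerivWithinAt u (du x) (Set.Icc (0 : ℝ) Rr) x)
    (hdu : ContinuousOn du (Set.Icc 0 Rr))
    (hNb : ∀ᵐ x ∂(volume.restrict (Set.Ioo (0 : ℝ) Rr)), N b x = u x)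
    {α : ℂ} {x : ℝ} (hx : x ∈ Set.Icc (0 : ℝ) Rr)
    (hα : ∀ (h : SchSp Rr) (g dg : ℝ → ℂ),
      SolvesAt Rr (fun t => (V t : ℂ)) z (res A z h) h g dg → bdryC Rr t0 tR g dg = 0 →
      ⟪N b', h⟫_ℂ = α * g x) :
    ⟪b', b⟫_ℂ = α * u x := by
  have hres := res_isResolvent hz
  have hNapp : ∀ v, N (N v) = res A z v := fun v => by rw [← hNN]; rfl
  have hNinj : Function.Injective N := fun v w hvw =>
    hres.injective (by rw [← hNapp, ← hNapp, hvw])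
  obtain ⟨y, hy, hylim⟩ := mem_closure_iff_seq_limit.1
    (denseRange_of_symmetric_of_injective hsymm hNinj b)
  choose h hh using hy
  obtain rfl : (fun n => N (h n)) = y := funext hh
  choose g dg hs hb using fun n => (hA.mem_graph_iff z _ _).1 (hres.mem_graph (h n))
  choose h0 hh0 hg using fun n => (hs n).exists_isPrimitiveTwice hR hV
  -- the derivatives of the approximants are bounded in `L²`
  have hDg : ∀ n, ∫ t in (0 : ℝ)..Rr, ‖dg n t‖ ^ 2 ≤ 2 * ‖N (h n)‖ ^ 2 := by
    intro n
    have h1 := hE _ _ _ (hg n) (hb n)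
    rw [← SchSp.inner_eq hR _ _ (hs n).1 (hh0 n), ← hNapp, hsymm] at h1
    have h2 : 0 ≤ ∫ t in (0 : ℝ)..Rr, ‖g n t‖ ^ 2 :=
      intervalIntegral.integral_nonneg hR.le fun _ _ => by positivity
    have h3 : (⟪N (h n), N (h n)⟫_ℂ).re = ‖N (h n)‖ ^ 2 := inner_self_eq_norm_sq (𝕜 := ℂ) _
    linarith
  obtain ⟨C, hC⟩ := hylim.norm.bddAbove_range
  have hdgc : ∀ n, ContinuousOn (dg n) (Set.Icc 0 Rr) := fun n => (hg n).continuousOn_deriv hR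
  have hDw : ∀ n, ∫ t in (0 : ℝ)..Rr, ‖dg n t - du t‖ ^ 2 ≤
      4 * C ^ 2 + 2 * ∫ t in (0 : ℝ)..Rr, ‖du t‖ ^ 2 := by
    intro n
    have i1 : IntervalIntegrable (fun t => ‖dg n t‖ ^ 2) volume 0 Rr :=
      ((hdgc n).norm.pow 2).intervalIntegrable_of_Icc hR.le
    have i2 : IntervalIntegrable (fun t => ‖du t‖ ^ 2) volume 0 Rr :=
      (hdu.norm.pow 2).intervalIntegrable_of_Icc hR.le
    have i3 : IntervalIntegrable (fun t => ‖dg n t - du t‖ ^ 2) volume 0 Rr :=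
      (((hdgc n).sub hdu).norm.pow 2).intervalIntegrable_of_Icc hR.le
    have h1 : ∫ t in (0 : ℝ)..Rr, ‖dg n t - du t‖ ^ 2 ≤
        ∫ t in (0 : ℝ)..Rr, (2 * ‖dg n t‖ ^ 2 + 2 * ‖du t‖ ^ 2) := by
      refine intervalIntegral.integral_mono_on hR.le i3
        ((i1.const_mul 2).add (i2.const_mul 2)) fun t _ => ?_
      have := norm_sub_le (dg n t) (du t)
      nlinarith [norm_nonneg (dg n t - du t), sq_nonneg (‖dg n t‖ - ‖du t‖)]
    rw [intervalIntegral.integral_add (i1.const_mul 2) (i2.const_mul 2),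
      intervalIntegral.integral_const_mul, intervalIntegral.integral_const_mul] at h1
    have h2 : ‖N (h n)‖ ≤ C := hC ⟨n, rfl⟩
    nlinarith [hDg n, norm_nonneg (N (h n))]
  have hL2 : Tendsto (fun n => ∫ t in (0 : ℝ)..Rr, ‖g n t - u t‖ ^ 2) atTop (nhds 0) := by
    have h1 : ∀ n, ∫ t in (0 : ℝ)..Rr, ‖g n t - u t‖ ^ 2 = ‖N (N (h n)) - N b‖ ^ 2 := by
      intro n
      refine (SchSp.norm_sq_eq hR _ ?_).symm
      filter_upwards [(hs n).1, hNb, Lp.coeFn_sub (N (N (h n))) (N b)] with t e1 e2 e3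
      rw [e3, Pi.sub_apply, e2, hNapp, e1]
    simp only [h1]
    have h2 := (((N.continuous.tendsto b).comp hylim).sub_const (N b)).norm.pow 2
    simpa using h2
  have hlim : Tendsto (fun n => g n x - u x) atTop (nhds 0) :=
    tendsto_apply_of_integral_sq_deriv_le hR (w := fun n t => g n t - u t)
      (dw := fun n t => dg n t - du t)
      (fun n t ht => ((hg n).hasDeriv t ht).sub (hu t ht)) (fun n => (hdgc n).sub hdu) hDw hL2 hx
  have hlim' : Tendsto (fun n => g n x) atTop (nhds (u x)) := by
    simpa using hlim.add_const (u x)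
  have h1 : Tendsto (fun n => ⟪b', N (h n)⟫_ℂ) atTop (nhds ⟪b', b⟫_ℂ) :=
    tendsto_const_nhds.inner hylim
  have h2 : ∀ n, ⟪b', N (h n)⟫_ℂ = α * g n x := fun n => by
    rw [← hsymm]; exact hα _ _ _ (hs n) (hb n)
  simp only [h2] at h1
  exact tendsto_nhds_unique h1 (hlim'.const_mul α)

open ComplexConjugate in
lemma eq_zero_of_energy_bound {Rr : ℝ} (hR : 0 < Rr) {q : ℝ → ℂ} {t0 tR : ℝ}
    (h0 : Real.sin t0 ≠ 0)
    (hE : ∀ g dg h : ℝ → ℂ, IsPrimitiveTwice Rr g dg (fun t => q t * g t - h t) →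
      bdryC Rr t0 tR g dg = 0 →
      (1 / 2) * (∫ t in (0 : ℝ)..Rr, ‖dg t‖ ^ 2) + ∫ t in (0 : ℝ)..Rr, ‖g t‖ ^ 2 ≤
        (∫ t in (0 : ℝ)..Rr, conj (g t) * h t).re)
    (g dg : ℝ → ℂ) (hg : IsPrimitiveTwice Rr g dg (fun t => q t * g t))
    (hb : bdryC Rr t0 tR g dg = 0) : g 0 = 0 ∧ dg 0 = 0 := by
  have h1 := hE g dg (fun _ => 0) (hg.congr fun t => (sub_zero _).symm) hb
  simp only [mul_zero, intervalIntegral.integral_zero, Complex.zero_re] at h1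
  have hD : 0 ≤ ∫ t in (0 : ℝ)..Rr, ‖dg t‖ ^ 2 :=
    intervalIntegral.integral_nonneg hR.le fun _ _ => by positivity
  have hN : 0 ≤ ∫ t in (0 : ℝ)..Rr, ‖g t‖ ^ 2 :=
    intervalIntegral.integral_nonneg hR.le fun _ _ => by positivity
  have hD' : ∫ t in (0 : ℝ)..Rr, ‖dg t‖ ^ 2 = 0 := by linarith
  have hN' : ∫ t in (0 : ℝ)..Rr, ‖g t‖ ^ 2 = 0 := by linarith
  have h2 := norm_sq_le_of_hasDerivWithinAt hR hg.hasDeriv (hg.continuousOn_deriv hR) one_pos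
    (Set.left_mem_Icc.2 hR.le)
  rw [hD', hN'] at h2
  have h3 : g 0 = 0 := by
    rw [← norm_eq_zero]
    exact pow_eq_zero_iff two_ne_zero |>.1 (le_antisymm (by simpa using h2) (by positivity))
  refine ⟨h3, ?_⟩
  rw [bdryC_zero_left h0 hb, h3]
  simp

/-- with `B(z) = (H' - z)^{1/2}[γ_{θ₀,θ_R}(H' - z)⁻¹]*` (characterized by
`(H' - z)^{-1/2} B(z) = [γ_{θ₀,θ_R}(H' - z)⁻¹]*`), for sufficiently negative real `z`,
`Λ_{θ₀',θ_R'}^{θ₀,θ_R}(z) S_{θ₀-θ₀',θ_R-θ_R'} = B(z)*B(z) +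
  diag(sin(θ₀-θ₀')sin θ₀ / sin θ₀', sin(θ_R-θ_R')sin θ_R / sin θ_R')`. -/
theorem statement14
    (Rr : ℝ) (hR : 0 < Rr) (V : ℝ → ℝ)
    (hV : MeasureTheory.IntegrableOn V (Set.Ioo 0 Rr) MeasureTheory.volume)
    (t0 tR t0' tR' : ℝ)
    (ht0 : t0 ∈ Set.Ioo 0 Real.pi) (htR : tR ∈ Set.Ioo 0 Real.pi)
    (ht0' : t0' ∈ Set.Ioo 0 Real.pi) (htR' : tR' ∈ Set.Ioo 0 Real.pi)
    (Hop Hop' : SchSp Rr →ₗ.[ℂ] SchSp Rr)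
    (hHop : IsSchrodingerOp Rr (fun x => (V x : ℂ)) (t0 : ℂ) (tR : ℂ) Hop)
    (hHop' : IsSchrodingerOp Rr (fun x => (V x : ℂ)) (t0' : ℂ) (tR' : ℂ) Hop')
    (hsa : IsSelfAdjoint Hop) (hsa' : IsSelfAdjoint Hop')
    (NH' : ℂ → (SchSp Rr →L[ℂ] SchSp Rr))
    (hNH' : IsSqrtResFam Rr Hop' (einf1 Rr Hop') NH')
    (Λ : ℂ → Matrix (Fin 2) (Fin 2) ℂ)
    (hΛ : ∀ z ∈ resolventSetP Hop',
      IsBoundaryDataMap Rr (fun x => (V x : ℂ)) (t0' : ℂ) (tR' : ℂ) (t0 : ℂ) (tR : ℂ) z (Λ z))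
    (G : ℂ → (SchSp Rr →L[ℂ] EuclideanSpace ℂ (Fin 2)))
    (hG : ∀ z ∈ resolventSetP Hop',
      IsBdryResolventMap Rr (fun x => (V x : ℂ)) (t0 : ℂ) (tR : ℂ) z Hop' (G z))
    (B : ℂ → (EuclideanSpace ℂ (Fin 2) →L[ℂ] SchSp Rr))
    (hB : ∀ z ∈ resolventSetP Hop',
      (NH' z).comp (B z) = ContinuousLinearMap.adjoint (G z)) :
    ∃ z0 : ℝ, z0 ≤ einf Rr Hop Hop' ∧
      ∀ z : ℝ, z < z0 →
        Λ (z : ℂ) *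
            Matrix.diagonal ![((Real.sin (t0 - t0') : ℝ) : ℂ), ((Real.sin (tR - tR') : ℝ) : ℂ)] =
          Matrix.of (fun i j : Fin 2 =>
            ⟪B (z : ℂ) (EuclideanSpace.single i 1), B (z : ℂ) (EuclideanSpace.single j 1)⟫_ℂ) +
          Matrix.diagonal
            ![((Real.sin (t0 - t0') * Real.sin t0 / Real.sin t0' : ℝ) : ℂ),
              ((Real.sin (tR - tR') * Real.sin tR / Real.sin tR' : ℝ) : ℂ)] := by
  have hVi : IntervalIntegrable V volume 0 Rr :=
    (intervalIntegrable_iff_integrable_restrict_Ioo hR).2 hV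
  have hVc : IntervalIntegrable (fun t => (V t : ℂ)) volume 0 Rr := ⟨hVi.1.ofReal, hVi.2.ofReal⟩
  have hs0 : Real.sin t0' ≠ 0 := (Real.sin_pos_of_pos_of_lt_pi ht0'.1 ht0'.2).ne'
  have hsR : Real.sin tR' ≠ 0 := (Real.sin_pos_of_pos_of_lt_pi htR'.1 htR'.2).ne'
  obtain ⟨z1, hz1⟩ := exists_energy_bound hR hVi hs0 hsR
  refine ⟨min z1 (min (einf Rr Hop Hop') (einf1 Rr Hop')),
    (min_le_right _ _).trans (min_le_left _ _), fun z hz => ?_⟩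
  have hE := hz1 z (hz.le.trans (min_le_left _ _))
  have hzc : z < einf1 Rr Hop' := hz.trans_le ((min_le_right _ _).trans (min_le_right _ _))
  have hqc : IntervalIntegrable (fun t => (V t : ℂ) - z) volume 0 Rr :=
    hVc.sub intervalIntegrable_const
  have hbvp := @exists_boundary_value_solution Rr hR _ hqc t0' tR' (eq_zero_of_energy_bound hR hs0 hE)
  have hres : (z : ℂ) ∈ resolventSetP Hop' := by
    refine mem_resolventSetP_of_bound (fun h => ?_) (fun f h hf => ?_)
    · obtain ⟨g, dg, hg, hb⟩ := hbvp
        (SchSp.intervalIntegrable hR h (Filter.Eventually.of_forall fun _ => rfl)) 0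
      obtain ⟨f, hf⟩ := SchSp.exists_of_continuousOn hg.continuousOn
      exact ⟨f, (hHop'.mem_graph_iff z f h).2
        ⟨g, dg, hg.solvesAt hf (Filter.Eventually.of_forall fun _ => rfl), hb⟩⟩
    · obtain ⟨g, dg, hs, hb⟩ := (hHop'.mem_graph_iff z f h).1 hf
      obtain ⟨h0, hh0, hg⟩ := hs.exists_isPrimitiveTwice hR hVc
      have h1 := hE _ _ _ hg hb
      rw [← SchSp.inner_eq hR _ _ hs.1 hh0, ← SchSp.norm_sq_eq hR _ hs.1] at h1
      have h2 : 0 ≤ ∫ t in (0 : ℝ)..Rr, ‖dg t‖ ^ 2 :=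
        intervalIntegral.integral_nonneg hR.le fun _ _ => by positivity
      have h3 : (⟪f, h⟫_ℂ).re ≤ ‖f‖ * ‖h‖ := re_inner_le_norm (𝕜 := ℂ) f h
      by_contra! hlt
      nlinarith [norm_nonneg f, norm_nonneg h]
  have hsymm := (hNH'.2.1 z hzc).1
  have hNN := hNH'.1 z (Or.inr (by simpa using hzc))
  set s : Fin 2 → ℝ := ![Real.sin (t0 - t0'), Real.sin (tR - tR')] with hs
  set σ : Fin 2 → ℝ := ![Real.sin t0', Real.sin tR'] with hσ
  set ρ : Fin 2 → ℝ := ![Real.sin t0, Real.sin tR] with hρ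
  have hσ0 : ∀ i, ((σ i : ℝ) : ℂ) ≠ 0 := by
    intro i
    rw [Complex.ofReal_ne_zero]
    fin_cases i
    · exact hs0
    · exact hsR
  -- `u j` represents the `j`-th column of `[γ (H' - z)⁻¹]*`
  choose u du hu hbu using fun j : Fin 2 => hbvp (h := fun _ => 0) intervalIntegrable_const
    (fun i => ((Pi.single j (s j) : Fin 2 → ℝ) i : ℂ))
  replace hu : ∀ j, IsPrimitiveTwice Rr (u j) (du j) (fun t => ((V t : ℂ) - z) * u j t) :=
    fun j => (hu j).congr fun t => sub_zero _
  have hGeval : ∀ (h : SchSp Rr) (g dg : ℝ → ℂ),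
      SolvesAt Rr (fun t => (V t : ℂ)) z (res Hop' z h) h g dg →
      bdryC Rr t0' tR' g dg = 0 → ∀ i, G z h i = -(s i : ℂ) / σ i * g (![0, Rr] i) := by
    intro h g dg hsol hb i
    rw [hG z hres h g dg hsol i, bdryC_eq_of_bdryC_eq hs0 hsR hb i]
    simp [hs, hσ]
  have hadj : ∀ (j : Fin 2) (h : SchSp Rr),
      ⟪ContinuousLinearMap.adjoint (G z) (EuclideanSpace.single j 1), h⟫_ℂ = G z h j := by
    intro j h
    rw [ContinuousLinearMap.adjoint_inner_left, EuclideanSpace.inner_single_left]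
    simp
  have hNB : ∀ j, NH' z (B z (EuclideanSpace.single j 1)) =
      ContinuousLinearMap.adjoint (G z) (EuclideanSpace.single j 1) := fun j => by
    rw [← hB z hres]; rfl
  have hcol : ∀ j, ∀ᵐ x ∂(volume.restrict (Set.Ioo (0 : ℝ) Rr)),
      NH' z (B z (EuclideanSpace.single j 1)) x = u j x := by
    intro j
    obtain ⟨f, hf⟩ := SchSp.exists_of_continuousOn (hu j).continuousOn
    suffices NH' z (B z (EuclideanSpace.single j 1)) = f by rw [this]; exact hf
    rw [hNB]
    refine ext_inner_right ℂ fun h => ?_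
    obtain ⟨g, dg, hsol, hb⟩ :=
      (hHop'.mem_graph_iff z _ _).1 ((res_isResolvent hres).mem_graph h)
    obtain ⟨h0, hh0, hg⟩ := hsol.exists_isPrimitiveTwice hR hVc
    rw [hadj, hGeval h g dg hsol hb, SchSp.inner_eq hR f h hf hh0,
      (hu j).integral_conj_mul_rhs hR hVc hs0 hsR (hbu j) hg hb]
    fin_cases j <;> simp [hσ]
  have hinner : ∀ i j : Fin 2,
      ⟪B z (EuclideanSpace.single i 1), B z (EuclideanSpace.single j 1)⟫_ℂ =
        -(s i : ℂ) / σ i * u j (![0, Rr] i) := by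
    intro i j
    refine hHop'.inner_eq_mul_apply hR hVc hE hres hsymm hNN (hu j).hasDeriv
      ((hu j).continuousOn_deriv hR) (hcol j) ?_ fun h g dg hsol hb => ?_
    · fin_cases i
      · exact ⟨le_rfl, hR.le⟩
      · exact ⟨hR.le, le_rfl⟩
    · rw [hNB, hadj, hGeval h g dg hsol hb]
  have hΛcol : ∀ i j : Fin 2, Λ z i j * (s j : ℂ) =
      -(s i : ℂ) / σ i * u j (![0, Rr] i) + (ρ i : ℂ) / σ i * (Pi.single j (s j) : Fin 2 → ℝ) i := by
    intro i j
    have h1 := congrFun (hΛ z hres (u j) (du j)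
      ⟨(hu j).hasDeriv, (hu j).eq_add_integral⟩) i
    rw [bdryC_eq_of_bdryC_eq hs0 hsR (hbu j) i, hbu j] at h1
    rw [← h1, Matrix.mulVec, dotProduct, Finset.sum_eq_single j]
    · simp
    · intro k _ hk
      simp [Pi.single_eq_of_ne hk]
    · simp
  ext i j
  rw [Matrix.add_apply, Matrix.of_apply, hinner]
  have h1 := hΛcol i j
  fin_cases i <;> fin_cases j <;>
    simp [Matrix.mul_apply, Fin.sum_univ_two, hs, hσ, hρ] at h1 ⊢ <;> rw [h1] <;> ring

end
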